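/- Let p be a real number with p < 0 or p > 1 and q, r ∈ (1,∞). Then for every k ∈ [0,1), E_{p,q,r}(k) = (π_{p,q}/2) · Σ_{n=0}^{∞} [(1/q)_n (−1/r*)_n / ((1 − 1/p + 1/q)_n · n!)] · k^{q n}, where 1/r + 1/r* = 1 and (x)_n = x(x+1)⋯(x+n−1) denotes the ascending Pochhammer symbol; in particular the series converges. -/

import Mathlib

open Real MeasureTheory Set Filter Polynomial

/-- The generalized complete elliptic integral of the second kind.
Here `1 - 1/r` is `1/r*` for the Hölder conjugate `r*` of `r`. -/
noncomputable def genE (p q r k : ℝ) : ℝ :=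
  ∫ t in (0:ℝ)..1, (1 - k ^ q * t ^ q) ^ (1 - 1 / r) * (1 - t ^ q) ^ (-(1 / p))

lemma aux_congr {f g : ℕ → ℝ} {y : ℝ} (h : ∀ n, f n = g n) (hg : HasSum g y) : HasSum f y := by
  rw [funext h]; exact hg

lemma aux_binom (b x : ℝ) (hx : |x| < 1) :
    HasSum (fun n : ℕ => (ascPochhammer ℝ n).eval (-b) / (n.factorial : ℝ) * x ^ n)
      ((1 - x) ^ b) := by
  have h := Real.one_div_one_sub_rpow_hasFPowerSeriesOnBall_zero (-b)
  have hx' : x ∈ Metric.eball (0:ℝ) 1 := by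
    have h2 : ‖x‖₊ < 1 := by
      rw [← NNReal.coe_lt_coe]; simpa using hx
    simp only [Metric.mem_eball, edist_zero_right, enorm_eq_nnnorm]
    exact_mod_cast h2
  have h1 := h.hasSum hx'
  have hpos : 0 ≤ 1 - x := by have := abs_lt.1 hx; linarith
  simp only [zero_add, rpow_neg hpos, one_div, inv_inv] at h1
  refine aux_congr (fun n => ?_) h1
  rw [FormalMultilinearSeries.ofScalars_apply_eq]
  have h3 : Ring.choose (-b + n - 1) n = Ring.multichoose (-b) n := by
    rw [Ring.choose]; congr 1; ring
  have h4 := Ring.factorial_nsmul_multichoose_eq_ascPochhammer (-b) n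
  rw [ascPochhammer_smeval_eq_eval, nsmul_eq_mul] at h4
  have h5 : (n.factorial : ℝ) ≠ 0 := by positivity
  rw [h3, smul_eq_mul, ← h4]
  field_simp

lemma aux_int (a q : ℝ) (ha : a < 1) (hq : 1 < q) :
    IntervalIntegrable (fun t : ℝ => (1 - t ^ q) ^ (-a)) volume 0 1 := by
  have h1 : IntervalIntegrable (fun t : ℝ => (1 - t) ^ (-a) + 1) volume 0 1 := by
    refine IntervalIntegrable.add ?_ intervalIntegrable_const
    have := (intervalIntegral.intervalIntegrable_rpow' (a := 0) (b := 1) (r := -a)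
      (by linarith)).comp_sub_left 1
    simpa using this.symm
  refine h1.mono_fun ?_ ?_
  · exact (by fun_prop : Measurable (fun t : ℝ => (1 - t ^ q) ^ (-a))).aestronglyMeasurable
  · rw [uIoc_of_le zero_le_one]
    filter_upwards [ae_restrict_mem measurableSet_Ioc] with t ht
    have h0 : t ^ q ≤ t := by
      simpa using rpow_le_rpow_of_exponent_ge ht.1 ht.2 hq.le
    have h0' : 0 ≤ t ^ q := rpow_nonneg ht.1.le _
    have hn : 0 ≤ 1 - t ^ q := by linarith [ht.2]
    have hn' : 0 ≤ 1 - t := by linarith [ht.2]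
    have p1 : 0 ≤ (1 - t ^ q) ^ (-a) := rpow_nonneg hn _
    have p2 : 0 ≤ (1 - t) ^ (-a) := rpow_nonneg hn' _
    rw [Real.norm_of_nonneg p1, Real.norm_of_nonneg (by positivity)]
    rcases le_or_gt 0 (-a) with h | h
    · have := rpow_le_one hn (by linarith) h
      linarith
    · rcases ht.2.lt_or_eq with h2 | h2
      · have := rpow_le_rpow_of_nonpos (sub_pos.2 h2) (by linarith : 1 - t ≤ 1 - t ^ q) h.le
        linarith
      · simp [h2]

lemma aux_int_mul (a q : ℝ) (ha : a < 1) (hq : 1 < q) (n : ℕ) :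
    IntervalIntegrable (fun t : ℝ => (t ^ q) ^ n * (1 - t ^ q) ^ (-a)) volume 0 1 := by
  refine (aux_int a q ha hq).continuousOn_mul ?_
  have : Continuous (fun t : ℝ => t ^ q) := Real.continuous_rpow_const (by linarith)
  exact (this.pow n).continuousOn

lemma aux_rec (a q : ℝ) (ha : a < 1) (hq : 1 < q) (n : ℕ) :
    (1 - a + 1 / q + n) * ∫ t in (0:ℝ)..1, (t ^ q) ^ (n + 1) * (1 - t ^ q) ^ (-a)
      = (1 / q + n) * ∫ t in (0:ℝ)..1, (t ^ q) ^ n * (1 - t ^ q) ^ (-a) := by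
  have hq0 : q ≠ 0 := by linarith
  have hc : Continuous (fun t : ℝ => t ^ q) := Real.continuous_rpow_const (by linarith)
  have hi := ((aux_int_mul a q ha hq n).const_mul (1 / q + n)).sub
    ((aux_int_mul a q ha hq (n + 1)).const_mul (1 - a + 1 / q + n))
  have key := intervalIntegral.integral_eq_sub_of_hasDerivAt_of_le (a := 0) (b := 1)
    (f := fun t : ℝ => (1 / q) * (t * (t ^ q) ^ n * (1 - t ^ q) ^ (1 - a))) zero_le_one ?_ ?_ hi
  · rw [intervalIntegral.integral_sub ((aux_int_mul a q ha hq n).const_mul _)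
      ((aux_int_mul a q ha hq (n + 1)).const_mul _), intervalIntegral.integral_const_mul,
      intervalIntegral.integral_const_mul] at key
    have h0 : (0:ℝ) ^ (1 - a) = 0 := zero_rpow (by linarith)
    simp only [one_rpow, sub_self, h0, mul_zero, zero_mul] at key
    linarith
  · have h2 : Continuous (fun t : ℝ => (1 - t ^ q) ^ (1 - a)) :=
      (continuous_const.sub hc).rpow_const (fun x => Or.inr (by linarith))
    exact (continuous_const.mul ((continuous_id.mul (hc.pow n)).mul h2)).continuousOn
  · intro t ht
    have hlt : t ^ q < 1 := rpow_lt_one ht.1.le ht.2 (by linarith)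
    have hpos : 0 < 1 - t ^ q := by linarith
    have d1 : HasDerivAt (fun t : ℝ => t ^ q) (q * t ^ (q - 1)) t :=
      Real.hasDerivAt_rpow_const (Or.inl ht.1.ne')
    have d2 := (d1.const_sub 1).rpow_const (p := 1 - a) (Or.inl hpos.ne')
    have d3 := ((((hasDerivAt_id t).mul (d1.pow n)).mul d2).const_mul (1 / q))
    convert! d3 using 1
    have e1 : t ^ q = t ^ (q - 1) * t := by
      rw [← rpow_add_one ht.1.ne']; ring_nf
    have e2 : (1 - t ^ q) ^ (1 - a) = (1 - t ^ q) ^ (-a) * (1 - t ^ q) := by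
      rw [← rpow_add_one hpos.ne']; ring_nf
    have e3 : (1 - a - 1) = -a := by ring
    simp only [e3, e2, id, Pi.mul_apply, Pi.pow_apply]
    generalize (1 - t ^ q) ^ (-a) = W
    rw [e1]
    generalize t ^ (q - 1) = S
    rcases n with _ | m
    · simp; field_simp; ring
    · simp only [Nat.add_sub_cancel, pow_succ]
      push_cast
      field_simp
      ring

lemma aux_mom (a q : ℝ) (ha : a < 1) (hq : 1 < q) (n : ℕ) :
    ∫ t in (0:ℝ)..1, (t ^ q) ^ n * (1 - t ^ q) ^ (-a) =
      (ascPochhammer ℝ n).eval (1 / q) / (ascPochhammer ℝ n).eval (1 - a + 1 / q) *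
      ∫ t in (0:ℝ)..1, (1 - t ^ q) ^ (-a) := by
  have hq0 : 0 < 1 / q := by positivity
  induction n with
  | zero => simp
  | succ n ih =>
    have h := aux_rec a q ha hq n
    rw [ih] at h
    have hp : 0 < 1 - a + 1 / q + n := by
      have : (0:ℝ) ≤ n := n.cast_nonneg
      linarith
    have hp2 : 0 < (ascPochhammer ℝ n).eval (1 - a + 1 / q) := ascPochhammer_pos n _ (by linarith)
    rw [ascPochhammer_succ_eval, ascPochhammer_succ_eval]
    have h' := (eq_div_iff hp.ne').2 ((mul_comm _ _).trans h)
    rw [h']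
    field_simp

theorem genE_series (p q r : ℝ) (hp : p < 0 ∨ 1 < p) (hq : 1 < q) (hr : 1 < r)
    (rs : ℝ) (hrs : 1 / r + 1 / rs = 1)
    (k : ℝ) (hk : k ∈ Ico (0:ℝ) 1)
    (pipq : ℝ) (hpipq : pipq = 2 * ∫ t in (0:ℝ)..1, (1 - t ^ q) ^ (-(1 / p))) :
    Summable (fun n : ℕ =>
      (ascPochhammer ℝ n).eval (1 / q) * (ascPochhammer ℝ n).eval (-(1 / rs))
        / ((ascPochhammer ℝ n).eval (1 - 1 / p + 1 / q) * (n.factorial : ℝ))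
        * k ^ (q * n))
    ∧ genE p q r k = (pipq / 2) * ∑' n : ℕ,
      (ascPochhammer ℝ n).eval (1 / q) * (ascPochhammer ℝ n).eval (-(1 / rs))
        / ((ascPochhammer ℝ n).eval (1 - 1 / p + 1 / q) * (n.factorial : ℝ))
        * k ^ (q * n) := by
  have ha : 1 / p < 1 := by
    rcases hp with h | h
    · have := one_div_neg.2 h; linarith
    · rw [div_lt_one (by linarith)]; exact h
  have hb : 1 - 1 / r = 1 / rs := by linarith
  obtain ⟨hk0, hk1⟩ := hk
  have hq0 : 0 < q := by linarith
  set x := k ^ q with hx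
  have hx0 : 0 ≤ x := rpow_nonneg hk0 _
  have hx1 : x < 1 := rpow_lt_one hk0 hk1 hq0
  have hkn : ∀ n : ℕ, k ^ (q * n) = x ^ n := fun n => by rw [hx, rpow_mul_natCast hk0]
  set w : ℝ → ℝ := fun t => (1 - t ^ q) ^ (-(1 / p)) with hw
  have hwi : IntervalIntegrable w volume 0 1 := aux_int (1 / p) q ha hq
  set c : ℕ → ℝ := fun n => (ascPochhammer ℝ n).eval (-(1 / rs)) / (n.factorial : ℝ) with hc
  have hS : Summable (fun n => |c n * x ^ n|) :=
    (aux_binom (1 / rs) x (by rwa [abs_of_nonneg hx0])).summable.abs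
  have hI : HasSum (fun n => ∫ t in (0:ℝ)..1, (c n * x ^ n) * ((t ^ q) ^ n * w t))
      (genE p q r k) := by
    unfold genE
    refine intervalIntegral.hasSum_integral_of_dominated_convergence
      (fun n t => |c n * x ^ n| * w t) ?_ ?_ ?_ ?_ ?_
    · intro n
      have : Measurable (fun t : ℝ => (c n * x ^ n) * ((t ^ q) ^ n * w t)) := by fun_prop
      exact this.aestronglyMeasurable
    · intro n
      refine ae_of_all _ fun t ht => ?_
      rw [uIoc_of_le zero_le_one] at ht
      have h0 : 0 ≤ t ^ q := rpow_nonneg ht.1.le _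
      have h1 : t ^ q ≤ 1 := rpow_le_one ht.1.le ht.2 hq0.le
      have hw0 : 0 ≤ w t := rpow_nonneg (by linarith) _
      rw [norm_mul, Real.norm_eq_abs, Real.norm_of_nonneg (by positivity)]
      refine mul_le_mul_of_nonneg_left ?_ (abs_nonneg _)
      exact mul_le_of_le_one_left hw0 (pow_le_one₀ h0 h1)
    · exact ae_of_all _ fun t _ => hS.mul_right _
    · simp only [tsum_mul_right]
      exact hwi.const_mul _
    · refine ae_of_all _ fun t ht => ?_
      rw [uIoc_of_le zero_le_one] at ht
      have h0 : 0 ≤ t ^ q := rpow_nonneg ht.1.le _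
      have h1 : t ^ q ≤ 1 := rpow_le_one ht.1.le ht.2 hq0.le
      have h2 : |x * t ^ q| < 1 := by
        rw [abs_of_nonneg (by positivity)]
        nlinarith
      have h3 := (aux_binom (1 / rs) (x * t ^ q) h2).mul_right (w t)
      rw [hb]
      refine aux_congr (fun n => ?_) h3
      rw [mul_pow]; ring
  have hM : pipq / 2 = ∫ t in (0:ℝ)..1, w t := by rw [hpipq]; ring
  have hMpos : 0 < pipq / 2 := by
    rw [hM]
    refine intervalIntegral.intervalIntegral_pos_of_pos_on hwi (fun t ht => ?_) zero_lt_one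
    have := rpow_lt_one ht.1.le ht.2 hq0
    exact rpow_pos_of_pos (by linarith) _
  have hT : HasSum (fun n : ℕ => (pipq / 2) * (
      (ascPochhammer ℝ n).eval (1 / q) * (ascPochhammer ℝ n).eval (-(1 / rs))
        / ((ascPochhammer ℝ n).eval (1 - 1 / p + 1 / q) * (n.factorial : ℝ))
        * k ^ (q * n))) (genE p q r k) := by
    convert hI using 2 with n
    rw [intervalIntegral.integral_const_mul, aux_mom (1 / p) q ha hq n, hkn, ← hM]
    simp only [hc]
    rw [mul_comm ((ascPochhammer ℝ n).eval (1 - 1 / p + 1 / q)), ← div_div]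
    ring
  refine ⟨(summable_mul_left_iff hMpos.ne').1 hT.summable, ?_⟩
  rw [← tsum_mul_left]
  exact hT.tsum_eq.symm
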